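/- Let T be a finite tree on n vertices. A vertex v minimizes Jordan centrality ψ_T over V(T) if and only if it minimizes closeness centrality C_T over V(T), if and only if it minimizes rumor centrality φ_T over V(T). In other words, the Jordan centers, closeness centers, and rumor centers of T are the same set of vertices (the centroids of T), and this set has one or two elements. -/

import Mathlib

open SimpleGraph Finset

variable {V : Type*} [Fintype V] [DecidableEq V]

/-- `(T,v)_{u↓}`: the set of vertices `w` whose unique path to `v` passes through `u`. -/
def subtreeSet (T : SimpleGraph V) (v u : V) : Set V :=
  {w | ∀ p : T.Path w v, u ∈ p.1.support}

/-- `|(T,v)_{u↓}|` -/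
noncomputable def subtreeCard (T : SimpleGraph V) (v u : V) : ℕ :=
  Nat.card (subtreeSet T v u)

/-- Jordan centrality `ψ_T(v) = max_{u ≠ v} |(T,v)_{u↓}|`; smaller is more central. -/
noncomputable def jordan (T : SimpleGraph V) (v : V) : ℕ :=
  (Finset.univ.erase v).sup fun u => subtreeCard T v u

/-- Closeness centrality `C_T(v) = Σ_{u ≠ v} dist(v,u)`; smaller is more central. -/
noncomputable def closeness (T : SimpleGraph V) (v : V) : ℕ :=
  ∑ u ∈ Finset.univ.erase v, T.dist v u

/-- Rumor centrality `φ_T(v) = Π_{u ≠ v} |(T,v)_{u↓}|`; smaller is more central. -/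
noncomputable def rumor (T : SimpleGraph V) (v : V) : ℕ :=
  ∏ u ∈ Finset.univ.erase v, subtreeCard T v u

/-- A centroid of `T`: removing `v` leaves a forest in which every connected
component has at most `n/2` vertices. -/
def IsCentroid (T : SimpleGraph V) (v : V) : Prop :=
  ∀ C : (T.induce {u | u ≠ v}).ConnectedComponent,
    2 * Nat.card C.supp ≤ Fintype.card V

theorem SimpleGraph.IsTree.length_eq_dist_of_isPath {W : Type*} {T : SimpleGraph W}
    (hT : T.IsTree) {u v : W} {p : T.Walk u v} (hp : p.IsPath) : p.length = T.dist u v := by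
  obtain ⟨q, hq, hl⟩ := hT.connected.exists_path_of_dist u v
  have h : (⟨p, hp⟩ : T.Path u v) = ⟨q, hq⟩ :=
    (hT.isAcyclic.subsingleton_path u v).elim _ _
  rw [← hl, Subtype.mk.inj h]

theorem SimpleGraph.Walk.dist_add_dist_of_mem_support {W : Type*} {T : SimpleGraph W}
    {w v x : W} {p : T.Walk w v} (hp : p.length = T.dist w v) (hx : x ∈ p.support) :
    T.dist w x + T.dist x v = T.dist w v := by
  classical
  have hl := congrArg Walk.length (p.take_spec hx)
  rw [Walk.length_append] at hl
  have h₁ := dist_le (p.takeUntil x hx)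
  have h₂ := dist_le (p.dropUntil x hx)
  have h₃ := (p.takeUntil x hx).reachable.dist_triangle_left v
  omega

theorem mem_subtreeSet_iff {W : Type*} {T : SimpleGraph W} (hT : T.IsTree) {v u w : W} :
    w ∈ subtreeSet T v u ↔ T.dist w u + T.dist u v = T.dist w v := by
  constructor
  · intro h
    obtain ⟨p, hp, hl⟩ := hT.connected.exists_path_of_dist w v
    exact Walk.dist_add_dist_of_mem_support hl (h ⟨p, hp⟩)
  · intro h p
    obtain ⟨q, -, hq⟩ := hT.connected.exists_path_of_dist w u
    obtain ⟨r, -, hr⟩ := hT.connected.exists_path_of_dist u v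
    have hqr : (q.append r).IsPath := by
      apply Walk.isPath_of_length_eq_dist
      rw [Walk.length_append]
      omega
    rw [(hT.isAcyclic.subsingleton_path w v).elim p ⟨_, hqr⟩]
    exact (Walk.mem_support_append_iff _ _).2 (Or.inl q.end_mem_support)

theorem self_mem_subtreeSet {W : Type*} (T : SimpleGraph W) (v u : W) : u ∈ subtreeSet T v u :=
  fun p => p.1.start_mem_support

theorem subtreeCard_pos {W : Type*} [Finite W] (T : SimpleGraph W) (v u : W) :
    0 < subtreeCard T v u := by
  have : Nonempty (subtreeSet T v u) := ⟨⟨u, self_mem_subtreeSet T v u⟩⟩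
  exact Nat.card_pos

theorem subtreeCard_le_of_subset {W : Type*} [Finite W] {T : SimpleGraph W}
    {v u v' u' : W} (h : subtreeSet T v u ⊆ subtreeSet T v' u') :
    subtreeCard T v u ≤ subtreeCard T v' u' :=
  Set.ncard_le_ncard h (Set.toFinite _)

theorem subtreeCard_lt_of_ssubset {W : Type*} [Finite W] {T : SimpleGraph W}
    {v u v' u' : W} (h : subtreeSet T v u ⊂ subtreeSet T v' u') :
    subtreeCard T v u < subtreeCard T v' u' :=
  Set.ncard_lt_ncard h (Set.toFinite _)

theorem mem_subtreeSet_of_adj_iff {W : Type*} {T : SimpleGraph W} (hT : T.IsTree) {v u w : W}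
    (h : T.Adj v u) : w ∈ subtreeSet T v u ↔ T.dist w u < T.dist w v := by
  rw [mem_subtreeSet_iff hT, dist_eq_one_iff_adj.2 h.symm]
  have := hT.dist_eq_dist_add_one_of_adj w h
  omega

theorem subtreeSet_compl_of_adj {W : Type*} {T : SimpleGraph W} (hT : T.IsTree) {v u : W}
    (h : T.Adj v u) : (subtreeSet T v u)ᶜ = subtreeSet T u v := by
  ext w
  rw [Set.mem_compl_iff, mem_subtreeSet_of_adj_iff hT h, mem_subtreeSet_of_adj_iff hT h.symm]
  have := hT.dist_ne_of_adj w h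
  omega

theorem subtreeCard_add_of_adj {W : Type*} [Fintype W] {T : SimpleGraph W} (hT : T.IsTree) {v u : W}
    (h : T.Adj v u) : subtreeCard T v u + subtreeCard T u v = Fintype.card W := by
  have := Set.ncard_add_ncard_compl (subtreeSet T v u)
  rwa [subtreeSet_compl_of_adj hT h, Nat.card_eq_fintype_card] at this

theorem SimpleGraph.Connected.exists_adj_dist_add_one {W : Type*} {T : SimpleGraph W}
    (hT : T.Connected) {v u : W} (h : u ≠ v) : ∃ x, T.Adj u x ∧ T.dist x v + 1 = T.dist u v := by
  obtain ⟨p, hp⟩ := hT.exists_walk_length_eq_dist u v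
  cases p with
  | nil => exact absurd rfl h
  | @cons _ x _ hx q =>
    refine ⟨x, hx, ?_⟩
    rw [Walk.length_cons] at hp
    have h₁ := dist_le q
    have h₂ := hT.dist_triangle (u := u) (v := x) (w := v)
    rw [dist_eq_one_iff_adj.2 hx] at h₂
    omega

/-- In a tree, every path between the two sides of an edge uses that edge. -/
theorem SimpleGraph.IsTree.dist_eq_of_sides {W : Type*} {T : SimpleGraph W} (hT : T.IsTree)
    {a b w v : W} (h : T.Adj a b) (hw : T.dist w a < T.dist w b)
    (hv : T.dist v b < T.dist v a) :
    T.dist w v = T.dist w a + 1 + T.dist b v := by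
  obtain ⟨p, hp, hpl⟩ := hT.connected.exists_path_of_dist w a
  obtain ⟨q, hq, hql⟩ := hT.connected.exists_path_of_dist b v
  have hpath : (p.append (Walk.cons h q)).IsPath := by
    rw [Walk.isPath_def, Walk.support_append, Walk.support_cons, List.tail_cons,
      List.nodup_append']
    refine ⟨hp.support_nodup, hq.support_nodup, ?_⟩
    intro x hxp hxq
    have h₁ := Walk.dist_add_dist_of_mem_support hpl hxp
    have h₂ := Walk.dist_add_dist_of_mem_support hql hxq
    have h₃ := hT.connected.dist_triangle (u := w) (v := x) (w := b)
    have h₄ := hT.connected.dist_triangle (u := v) (v := x) (w := a)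
    have h₅ := T.dist_comm (u := v) (v := x)
    have h₆ := T.dist_comm (u := v) (v := b)
    have h₇ := T.dist_comm (u := x) (v := b)
    omega
  rw [← hT.length_eq_dist_of_isPath hpath, Walk.length_append, Walk.length_cons, hpl, hql]
  omega

theorem subtreeSet_eq_of_side {W : Type*} {T : SimpleGraph W} (hT : T.IsTree) {a b v : W}
    (h : T.Adj a b) (hv : T.dist v b < T.dist v a) : subtreeSet T v a = subtreeSet T b a := by
  have hav : T.dist a v = 1 + T.dist b v := by
    have := hT.dist_eq_of_sides h (w := a) (by simp [dist_eq_one_iff_adj.2 h]) hv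
    simpa using this
  ext w
  rw [mem_subtreeSet_iff hT, mem_subtreeSet_of_adj_iff hT h.symm]
  constructor
  · intro hw
    have := hT.connected.dist_triangle (u := w) (v := b) (w := v)
    omega
  · intro hw
    have := hT.dist_eq_of_sides h hw hv
    omega

/-- Moving the root along an edge only changes the subtrees of the two ends of that edge. -/
theorem subtreeSet_eq_of_adj {W : Type*} {T : SimpleGraph W} (hT : T.IsTree) {u v w : W}
    (h : T.Adj v u) (hv : w ≠ v) (hu : w ≠ u) : subtreeSet T v w = subtreeSet T u w := by
  obtain ⟨x, hx, hd⟩ := hT.connected.exists_adj_dist_add_one hv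
  have hvx : T.dist v x < T.dist v w := by
    rw [T.dist_comm (u := v), T.dist_comm (u := v)]
    omega
  rw [subtreeSet_eq_of_side hT hx hvx]
  refine (subtreeSet_eq_of_side hT hx ?_).symm
  by_contra hn
  have hlt : T.dist u w < T.dist u x := by
    have := hT.dist_ne_of_adj u hx
    omega
  have h₁ := hT.dist_eq_of_sides hx hlt hvx
  rw [dist_eq_one_iff_adj.2 h.symm] at h₁
  exact hu (hT.connected.dist_eq_zero_iff.1 (by omega : T.dist u w = 0)).symm

theorem subtreeSet_subset {W : Type*} {T : SimpleGraph W} (hT : T.IsTree) {v x u : W}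
    (h : u ∈ subtreeSet T v x) : subtreeSet T v u ⊆ subtreeSet T v x := by
  intro w hw
  rw [mem_subtreeSet_iff hT] at *
  have h₁ := hT.connected.dist_triangle (u := w) (v := u) (w := x)
  have h₂ := hT.connected.dist_triangle (u := w) (v := x) (w := v)
  omega

theorem subtreeCard_lt {W : Type*} [Finite W] {T : SimpleGraph W} (hT : T.IsTree) {v x u : W}
    (h : u ∈ subtreeSet T v x) (hne : u ≠ x) : subtreeCard T v u < subtreeCard T v x := by
  refine subtreeCard_lt_of_ssubset ((Set.ssubset_iff_of_subset (subtreeSet_subset hT h)).2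
    ⟨x, self_mem_subtreeSet T v x, ?_⟩)
  rw [mem_subtreeSet_iff hT] at *
  have := hT.connected.pos_dist_of_ne hne
  omega

/-- The balance condition at `v`: each subtree hanging off `v` has at most half the vertices. -/
def IsBalanced (T : SimpleGraph V) (v : V) : Prop :=
  ∀ u, T.Adj v u → 2 * subtreeCard T v u ≤ Fintype.card V

theorem IsBalanced.two_mul_subtreeCard_le {W : Type*} [Fintype W] {T : SimpleGraph W}
    (hT : T.IsTree) {v x u : W} (hv : IsBalanced T v) (hne : u ≠ v)
    (hx : T.Adj u x) (hd : T.dist x v + 1 = T.dist u v) :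
    2 * subtreeCard T x u ≤ Fintype.card W ∧
      (x ≠ v → 2 * subtreeCard T x u < Fintype.card W) := by
  have hs : subtreeCard T x u = subtreeCard T v u := by
    have hlt : T.dist v x < T.dist v u := by
      rw [T.dist_comm (u := v), T.dist_comm (u := v)]
      omega
    rw [subtreeCard, subtreeCard, subtreeSet_eq_of_side hT hx hlt]
  obtain ⟨y, hy, hyd⟩ := hT.connected.exists_adj_dist_add_one hne.symm
  have hu : u ∈ subtreeSet T v y := by
    rw [mem_subtreeSet_of_adj_iff hT hy, T.dist_comm (u := u), T.dist_comm (u := u)]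
    omega
  have hyv := hv y hy
  have hle := subtreeCard_le_of_subset (subtreeSet_subset hT hu)
  refine ⟨by omega, fun hxv => ?_⟩
  have hpos := hT.connected.pos_dist_of_ne hxv
  have hlt := subtreeCard_lt hT hu (by
    rintro rfl
    rw [dist_eq_one_iff_adj.2 hy.symm] at hd
    omega)
  omega

/-- A function which is compared across each edge by the sizes of the two sides
of that edge is minimized exactly at the balanced vertices. -/
theorem isMin_iff_isBalanced {W : Type*} [Fintype W] {T : SimpleGraph W} (hT : T.IsTree) {f : W → ℕ}
    (hf : ∀ v u, T.Adj v u → (f v ≤ f u ↔ 2 * subtreeCard T v u ≤ Fintype.card W)) (v : W) :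
    (∀ u, f v ≤ f u) ↔ IsBalanced T v := by
  refine ⟨fun h u hu => (hf v u hu).1 (h u), fun hv u => ?_⟩
  induction hk : T.dist u v generalizing u with
  | zero => rw [hT.connected.dist_eq_zero_iff.1 hk]
  | succ k ih =>
    have hne : u ≠ v := by
      rintro rfl
      simp at hk
    obtain ⟨x, hx, hd⟩ := hT.connected.exists_adj_dist_add_one hne
    exact (ih x (by omega)).trans
      ((hf x u hx.symm).2 (hv.two_mul_subtreeCard_le hT hne hx hd).1)

theorem IsBalanced.adj {T : SimpleGraph V} (hT : T.IsTree) {v u : V} (hv : IsBalanced T v)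
    (hu : IsBalanced T u) (hne : u ≠ v) : T.Adj u v := by
  obtain ⟨x, hx, hd⟩ := hT.connected.exists_adj_dist_add_one hne
  by_cases hxv : x = v
  · exact hxv ▸ hx
  · have h₁ := (hv.two_mul_subtreeCard_le hT hne hx hd).2 hxv
    have h₂ := hu x hx
    have h₃ := subtreeCard_add_of_adj hT hx
    omega

theorem closeness_eq_sum_dist (T : SimpleGraph V) (v : V) : closeness T v = ∑ u, T.dist u v := by
  rw [closeness, Finset.sum_erase _ T.dist_self]
  exact Finset.sum_congr rfl fun _ _ => T.dist_comm

theorem closeness_add_subtreeCard_of_adj {T : SimpleGraph V} (hT : T.IsTree) {v u : V}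
    (h : T.Adj v u) :
    closeness T v + subtreeCard T u v = closeness T u + subtreeCard T v u := by
  classical
  have hcard : ∀ a b, subtreeCard T a b = ∑ w, if w ∈ subtreeSet T a b then 1 else 0 := by
    intro a b
    rw [Finset.sum_boole, Nat.cast_id, subtreeCard, Nat.card_eq_fintype_card,
      Fintype.card_subtype]
  rw [hcard, hcard, closeness_eq_sum_dist, closeness_eq_sum_dist, ← Finset.sum_add_distrib,
    ← Finset.sum_add_distrib]
  refine Finset.sum_congr rfl fun w _ => ?_
  rw [mem_subtreeSet_of_adj_iff hT h, mem_subtreeSet_of_adj_iff hT h.symm]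
  have := hT.dist_eq_dist_add_one_of_adj w h
  split_ifs <;> omega

theorem closeness_le_iff {T : SimpleGraph V} (hT : T.IsTree) (v u : V) (h : T.Adj v u) :
    closeness T v ≤ closeness T u ↔ 2 * subtreeCard T v u ≤ Fintype.card V := by
  have h₁ := closeness_add_subtreeCard_of_adj hT h
  have h₂ := subtreeCard_add_of_adj hT h
  omega

theorem rumor_le_iff {T : SimpleGraph V} (hT : T.IsTree) (v u : V) (h : T.Adj v u) :
    rumor T v ≤ rumor T u ↔ 2 * subtreeCard T v u ≤ Fintype.card V := by
  have hu : u ∈ Finset.univ.erase v := by simp [h.ne']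
  have hv : v ∈ Finset.univ.erase u := by simp [h.ne]
  have hrest : ∏ w ∈ (Finset.univ.erase u).erase v, subtreeCard T u w =
      ∏ w ∈ (Finset.univ.erase v).erase u, subtreeCard T v w := by
    rw [Finset.erase_right_comm]
    refine Finset.prod_congr rfl fun w hw => ?_
    simp only [Finset.mem_erase, Finset.mem_univ, and_true] at hw
    rw [subtreeCard, subtreeCard, subtreeSet_eq_of_adj hT h hw.2 hw.1]
  rw [rumor, rumor, ← Finset.mul_prod_erase _ _ hu, ← Finset.mul_prod_erase _ _ hv, hrest,
    Nat.mul_le_mul_right_iff (Finset.prod_pos fun w _ => subtreeCard_pos T v w)]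
  have := subtreeCard_add_of_adj hT h
  omega

theorem subtreeCard_le_jordan {T : SimpleGraph V} {v u : V} (h : u ≠ v) :
    subtreeCard T v u ≤ jordan T v :=
  Finset.le_sup (f := fun u => subtreeCard T v u) (by simp [h])

theorem jordan_le_iff {T : SimpleGraph V} (hT : T.IsTree) (v u : V) (h : T.Adj v u) :
    jordan T v ≤ jordan T u ↔ 2 * subtreeCard T v u ≤ Fintype.card V := by
  have hadd := subtreeCard_add_of_adj hT h
  have hu := subtreeCard_le_jordan (T := T) h.ne'
  have hv := subtreeCard_le_jordan (T := T) h.ne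
  constructor
  · contrapose!
    intro hlt
    refine (Finset.sup_lt_iff ((subtreeCard_pos T v u).trans_le hu)).2 fun w hw => ?_
    simp only [Finset.mem_erase, Finset.mem_univ, and_true] at hw
    refine lt_of_lt_of_le ?_ hu
    by_cases hwu : w ∈ subtreeSet T v u
    · have hwv : w ≠ v := by
        rintro rfl
        rw [mem_subtreeSet_of_adj_iff hT h] at hwu
        simp at hwu
      have := subtreeCard_lt hT hwu hw
      rwa [subtreeCard, subtreeSet_eq_of_adj hT h hwv hw] at this
    · rw [← Set.mem_compl_iff, subtreeSet_compl_of_adj hT h] at hwu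
      have := subtreeCard_le_of_subset (subtreeSet_subset hT hwu)
      omega
  · intro hle
    refine Finset.sup_le fun w hw => ?_
    simp only [Finset.mem_erase, Finset.mem_univ, and_true] at hw
    by_cases hwu : w = u
    · subst hwu
      omega
    · rw [subtreeCard, subtreeSet_eq_of_adj hT h hw hwu]
      exact subtreeCard_le_jordan hwu

theorem mem_subtreeSet_of_reachable_induce {W : Type*} {T : SimpleGraph W} (hT : T.IsTree) {v u : W}
    (h : T.Adj v u) {x y : {z : W | z ≠ v}} (hr : (T.induce {z | z ≠ v}).Reachable x y)
    (hx : x.1 ∈ subtreeSet T v u) : y.1 ∈ subtreeSet T v u := by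
  obtain ⟨p⟩ := hr
  induction p with
  | nil => exact hx
  | @cons a b c hab _ ih =>
    refine ih ?_
    by_contra hb
    rw [← Set.mem_compl_iff, subtreeSet_compl_of_adj hT h,
      mem_subtreeSet_of_adj_iff hT h.symm] at hb
    rw [mem_subtreeSet_of_adj_iff hT h] at hx
    have hd := hT.dist_eq_of_sides h.symm hx hb
    rw [dist_eq_one_iff_adj.2 (induce_adj.1 hab)] at hd
    exact b.2 (hT.connected.dist_eq_zero_iff.1 (by omega : T.dist v b.1 = 0)).symm

theorem image_supp_connectedComponentMk {W : Type*} {T : SimpleGraph W} (hT : T.IsTree) {v u : W}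
    (h : T.Adj v u) :
    Subtype.val '' ((T.induce {z | z ≠ v}).connectedComponentMk ⟨u, h.ne'⟩).supp =
      subtreeSet T v u := by
  ext w
  simp only [Set.mem_image, ConnectedComponent.mem_supp_iff, ConnectedComponent.eq]
  constructor
  · rintro ⟨y, hy, rfl⟩
    exact mem_subtreeSet_of_reachable_induce hT h hy.symm (self_mem_subtreeSet T v u)
  · intro hw
    obtain ⟨p, hp⟩ := hT.connected.exists_walk_length_eq_dist w u
    rw [mem_subtreeSet_of_adj_iff hT h] at hw
    have hpv : ∀ x ∈ p.support, x ∈ {z : W | z ≠ v} := by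
      rintro x hx rfl
      have := Walk.dist_add_dist_of_mem_support hp hx
      omega
    exact ⟨⟨w, hpv w p.start_mem_support⟩, ⟨p.induce _ hpv⟩, rfl⟩

theorem card_supp_connectedComponentMk {W : Type*} {T : SimpleGraph W} (hT : T.IsTree) {v u : W}
    (h : T.Adj v u) :
    Nat.card ((T.induce {z | z ≠ v}).connectedComponentMk ⟨u, h.ne'⟩).supp =
      subtreeCard T v u := by
  rw [subtreeCard, ← image_supp_connectedComponentMk hT h,
    Nat.card_image_of_injective Subtype.val_injective]

theorem isCentroid_iff_isBalanced {W : Type*} [Fintype W] {T : SimpleGraph W} (hT : T.IsTree)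
    (v : W) : IsCentroid T v ↔ IsBalanced T v := by
  constructor
  · intro h u hu
    rw [← card_supp_connectedComponentMk hT hu]
    exact h _
  · intro h C
    induction C using ConnectedComponent.ind with
    | h w =>
      obtain ⟨u, hu, hd⟩ := hT.connected.exists_adj_dist_add_one (Ne.symm w.2)
      have hw : w.1 ∈ subtreeSet T v u := by
        rw [mem_subtreeSet_of_adj_iff hT hu, T.dist_comm (u := w.1), T.dist_comm (u := w.1)]
        omega
      rw [← image_supp_connectedComponentMk hT hu] at hw
      obtain ⟨y, hy, hyw⟩ := hw
      obtain rfl := Subtype.ext hyw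
      rw [ConnectedComponent.mem_supp_iff] at hy
      rw [hy, card_supp_connectedComponentMk hT hu]
      exact h u hu

theorem card_isBalanced_le_two {T : SimpleGraph V} (hT : T.IsTree) :
    {v | IsBalanced T v}.ncard ≤ 2 := by
  by_contra! h
  obtain ⟨a, ha, b, hb, c, hc, hab, hac, hbc⟩ := (Set.two_lt_ncard (Set.toFinite _)).1 h
  have h₁ := dist_eq_one_iff_adj.2 (IsBalanced.adj hT hb ha hab)
  have h₂ := dist_eq_one_iff_adj.2 (IsBalanced.adj hT hc ha hac)
  exact hT.dist_ne_of_adj a (IsBalanced.adj hT hc hb hbc) (h₁.trans h₂.symm)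

/-- In a finite tree, the Jordan centers, closeness centers and rumor centers
coincide, they are exactly the centroids, and there are one or two of them. -/
theorem centers_coincide (T : SimpleGraph V) (hT : T.IsTree) :
    (∀ v : V,
      ((∀ u, jordan T v ≤ jordan T u) ↔ (∀ u, closeness T v ≤ closeness T u)) ∧
      ((∀ u, jordan T v ≤ jordan T u) ↔ (∀ u, rumor T v ≤ rumor T u)) ∧
      ((∀ u, jordan T v ≤ jordan T u) ↔ IsCentroid T v)) ∧
    (Nat.card {v : V // ∀ u, jordan T v ≤ jordan T u} = 1 ∨
      Nat.card {v : V // ∀ u, jordan T v ≤ jordan T u} = 2) := by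
  have hJ := isMin_iff_isBalanced hT (jordan_le_iff hT)
  have hC := isMin_iff_isBalanced hT (closeness_le_iff hT)
  have hR := isMin_iff_isBalanced hT (rumor_le_iff hT)
  refine ⟨fun v => ⟨(hJ v).trans (hC v).symm, (hJ v).trans (hR v).symm,
    (hJ v).trans (isCentroid_iff_isBalanced hT v).symm⟩, ?_⟩
  have := hT.connected.nonempty
  obtain ⟨v, hv⟩ := Finite.exists_min (jordan T)
  have : Nonempty {v : V // ∀ u, jordan T v ≤ jordan T u} := ⟨⟨v, hv⟩⟩
  have hpos : 0 < Nat.card {v : V // ∀ u, jordan T v ≤ jordan T u} := Nat.card_pos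
  have hle : Nat.card {v : V // ∀ u, jordan T v ≤ jordan T u} ≤ 2 := by
    simp only [hJ]
    exact card_isBalanced_le_two hT
  omega
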